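/- arXiv:2201.09556 — 2 statements merged into one kernel-verified Lean document; each statement's English description precedes it below -/
import Mathlib

section
/- For every k ≥ 0, every j ≥ 0, and every n ≤ 3^k, the function q_j satisfies |q_j(n) − q_j(3^k − n)| ≤ 1. -/
/-- A palindrome: a word equal to its reversal. -/
def IsPal {α : Type*} (w : List α) : Prop := w.reverse = w

/-- Palindromic length: the minimal number of palindromes whose concatenation is `w`. -/
noncomputable def PL {α : Type*} (w : List α) : ℕ :=
  sInf {k | ∃ l : List (List α), l.length = k ∧ (∀ p ∈ l, IsPal p) ∧ l.flatten = w}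


/-- The morphism φ : a → aba, b → bbb, with a = false, b = true. -/
def phi (w : List Bool) : List Bool :=
  w.flatMap fun c => if c then [true, true, true] else [false, true, false]

/-- The Sierpinski word, fixed point of φ starting with a: its (n+1)-st letter. -/
def sW (n : ℕ) : Bool := (phi^[n+1] [false]).getD n true

/-- The prefix s[1..n] of the Sierpinski word. -/
def sPrefix (n : ℕ) : List Bool := (List.range n).map sW

/-- qⱼ(n) = PL(bʲ s[1..n]). -/
noncomputable def qj (j n : ℕ) : ℕ := PL (List.replicate j true ++ sPrefix n)

/-- q(n) = min over j of qⱼ(n). -/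
noncomputable def qS (n : ℕ) : ℕ := sInf (Set.range fun j => qj j n)

/-- p(n) = PL(s[1..n]), the prefix palindromic length of the Sierpinski word. -/
noncomputable def pS (n : ℕ) : ℕ := PL (sPrefix n)

/-- `w` is a concatenation of `k` (possibly empty) palindromes. -/
def IsPalProd {α : Type*} (k : ℕ) (w : List α) : Prop :=
  ∃ l : List (List α), l.length = k ∧ (∀ p ∈ l, IsPal p) ∧ l.flatten = w

theorem IsPalProd.cons {α : Type*} {k : ℕ} {p w : List α} (hp : IsPal p) (hw : IsPalProd k w) :
    IsPalProd (k + 1) (p ++ w) := by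
  obtain ⟨l, rfl, hl, rfl⟩ := hw
  exact ⟨p :: l, rfl, by simpa using ⟨hp, hl⟩, rfl⟩

theorem isPalProd_zero {α : Type*} {w : List α} : IsPalProd 0 w ↔ w = [] := by
  constructor
  · rintro ⟨l, hl, -, rfl⟩
    simp [List.length_eq_zero_iff.mp hl]
  · rintro rfl
    exact ⟨[], rfl, by simp, rfl⟩

theorem IsPalProd.exists_of_succ {α : Type*} {k : ℕ} {w : List α} (h : IsPalProd (k + 1) w) :
    ∃ p v, IsPal p ∧ IsPalProd k v ∧ w = p ++ v := by
  obtain ⟨l, hk, hl, rfl⟩ := h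
  cases l with
  | nil => simp at hk
  | cons p l =>
    simp only [List.mem_cons, forall_eq_or_imp] at hl
    exact ⟨p, l.flatten, hl.1, ⟨l, by simpa using hk, hl.2, rfl⟩, rfl⟩

theorem IsPalProd.reverse {α : Type*} {k : ℕ} {w : List α} (h : IsPalProd k w) :
    IsPalProd k w.reverse := by
  obtain ⟨l, rfl, hl, rfl⟩ := h
  refine ⟨l.reverse, by simp, by simpa using hl, ?_⟩
  rw [List.reverse_flatten]
  congr 2
  conv_lhs => rw [← List.map_id l]
  exact List.map_congr_left fun p hp => (hl p hp).symm

theorem isPalProd_PL {α : Type*} (w : List α) : IsPalProd (PL w) w := by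
  refine Nat.sInf_mem (s := {k | IsPalProd k w}) ?_
  induction w with
  | nil => exact ⟨0, isPalProd_zero.mpr rfl⟩
  | cons a w ih =>
    obtain ⟨k, hk⟩ := ih
    exact ⟨k + 1, IsPalProd.cons (p := [a]) rfl hk⟩

theorem IsPalProd.PL_le {α : Type*} {k : ℕ} {w : List α} (h : IsPalProd k w) : PL w ≤ k :=
  Nat.sInf_le h

theorem PL_reverse {α : Type*} (w : List α) : PL w.reverse = PL w := by
  refine le_antisymm (isPalProd_PL w).reverse.PL_le ?_
  simpa using (isPalProd_PL w.reverse).reverse.PL_le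

/-- The middle of a palindrome is a palindrome. -/
theorem IsPal.of_reverse_append_append {α : Type*} {x p : List α}
    (h : IsPal (x.reverse ++ (p ++ x))) : IsPal p := by
  simpa [IsPal] using h

/-- If a palindrome has a palindromic prefix, the remaining suffix is a product of two
palindromes. -/
theorem exists_isPal_append_isPal {α : Type*} (p t : List α) (hp : IsPal p)
    (h : IsPal (p ++ t)) : ∃ x y, IsPal x ∧ IsPal y ∧ t = x ++ y := by
  have h' : t.reverse ++ p = p ++ t := by
    have := h
    rwa [IsPal, List.reverse_append, hp] at this
  rcases List.append_eq_append_iff.mp h' with ⟨s, rfl, hs⟩ | ⟨s, ht, hs⟩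
  · by_cases ht : t = []
    · exact ⟨[], [], rfl, rfl, ht⟩
    have hlen : s.length < (t.reverse ++ s).length := by
      have := List.length_pos_iff.mpr ht
      simp; omega
    have hst : IsPal (s ++ t) := hs ▸ hp
    have hsp : IsPal s := by
      rw [List.append_assoc] at h
      exact h.of_reverse_append_append
    exact exists_isPal_append_isPal s t hsp hst
  · refine ⟨s, p, ?_, hp, hs⟩
    rw [hs] at h
    have hp' : p.reverse = p := hp
    rw [← hp', ← List.append_assoc] at h
    simpa [IsPal, hp'] using h
termination_by p.length

/-- Removing a palindromic prefix increases the palindromic length by at most one. -/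
theorem IsPalProd.of_append {α : Type*} (k : ℕ) (p z : List α) (hp : IsPal p)
    (h : IsPalProd k (p ++ z)) : IsPalProd (k + 1) z := by
  cases k with
  | zero =>
    have hz := isPalProd_zero.mp h
    rw [List.append_eq_nil_iff] at hz
    rw [hz.2]
    exact IsPalProd.cons (p := []) rfl (isPalProd_zero.mpr rfl)
  | succ k =>
    obtain ⟨q, w, hq, hw, heq⟩ := h.exists_of_succ
    by_cases hq0 : q = []
    · subst hq0
      have hk : IsPalProd k (p ++ z) := by rw [heq]; exact hw
      exact IsPalProd.cons (p := []) rfl (IsPalProd.of_append k p z hp hk)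
    have hqpos := List.length_pos_iff.mpr hq0
    rcases List.append_eq_append_iff.mp heq with ⟨t, rfl, rfl⟩ | ⟨t, hpt, rfl⟩
    · obtain ⟨x, y, hx, hy, rfl⟩ := exists_isPal_append_isPal p t hp hq
      rw [List.append_assoc]
      exact (hw.cons hy).cons hx
    · obtain ⟨x, y, hx, hy, rfl⟩ := exists_isPal_append_isPal q t hq (hpt ▸ hp)
      have hlen : p.length = q.length + (x.length + y.length) := by simp [hpt]
      rw [List.append_assoc] at hw
      have hyz := IsPalProd.of_append k x (y ++ z) hx hw
      exact IsPalProd.of_append (k + 1) y z hy hyz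
termination_by (p.length + z.length, k)
decreasing_by
  · exact Prod.Lex.right _ (by omega)
  · exact Prod.Lex.left _ _ (by rw [List.length_append]; omega)
  · exact Prod.Lex.left _ _ (by omega)

theorem PL_le_PL_append_add_one {α : Type*} {p : List α} (hp : IsPal p) (z : List α) :
    PL z ≤ PL (p ++ z) + 1 :=
  (IsPalProd.of_append _ p z hp (isPalProd_PL _)).PL_le

theorem PL_append_le_PL_add_one {α : Type*} {p : List α} (hp : IsPal p) (z : List α) :
    PL (p ++ z) ≤ PL z + 1 :=
  ((isPalProd_PL z).cons hp).PL_le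

/-- The two factors of a factorization of a palindrome have palindromic lengths that differ by
at most one. -/
theorem IsPal.abs_PL_sub_PL_le_one {α : Type*} {x y : List α} (h : IsPal (x ++ y)) :
    |(PL x : ℤ) - PL y| ≤ 1 := by
  have h' : y.reverse ++ x.reverse = x ++ y := by
    have := h
    rwa [IsPal, List.reverse_append] at this
  rcases List.append_eq_append_iff.mp h' with ⟨s, rfl, hs⟩ | ⟨s, hy, hs⟩
  · have hsp : IsPal s := by
      rw [List.append_assoc] at h
      exact h.of_reverse_append_append
    have e : PL (y.reverse ++ s) = PL (s ++ y) := by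
      rw [← PL_reverse, hs]
    have h1 := PL_le_PL_append_add_one hsp y
    have h2 := PL_append_le_PL_add_one hsp y
    rw [e, abs_le]
    omega
  · have hsp : IsPal s := by
      rw [hs] at h
      exact IsPal.of_reverse_append_append (x := x.reverse) (by simpa using h)
    have e : PL y = PL (s ++ x.reverse) := by rw [hs]
    have h1 := PL_le_PL_append_add_one hsp x.reverse
    have h2 := PL_append_le_PL_add_one hsp x.reverse
    rw [PL_reverse] at h1 h2
    rw [e, abs_le]
    omega

theorem length_phi (w : List Bool) : (phi w).length = 3 * w.length := by
  induction w with
  | nil => rfl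
  | cons c w ih =>
    cases c <;> simp_all [phi] <;> omega

theorem phi_append (u v : List Bool) : phi (u ++ v) = phi u ++ phi v := by
  simp [phi]

theorem phi_reverse (w : List Bool) : phi w.reverse = (phi w).reverse := by
  induction w with
  | nil => rfl
  | cons c w ih =>
    rw [List.reverse_cons, phi_append, ih, ← List.singleton_append (l := w), phi_append,
      List.reverse_append]
    cases c <;> rfl

theorem length_iterate_phi (k : ℕ) : (phi^[k] [false]).length = 3 ^ k := by
  induction k with
  | zero => rfl
  | succ k ih => rw [Function.iterate_succ_apply', length_phi, ih, pow_succ, mul_comm]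

theorem isPal_iterate_phi (k : ℕ) : IsPal (phi^[k] [false]) := by
  induction k with
  | zero => rfl
  | succ k ih =>
    rw [Function.iterate_succ_apply', IsPal, ← phi_reverse, ih]

theorem iterate_phi_prefix_succ (k : ℕ) : phi^[k] [false] <+: phi^[k + 1] [false] := by
  induction k with
  | zero => exact ⟨[true, false], rfl⟩
  | succ k ih =>
    obtain ⟨t, ht⟩ := ih
    refine ⟨phi t, ?_⟩
    rw [Function.iterate_succ_apply', ← phi_append, ht, ← Function.iterate_succ_apply' phi]

theorem iterate_phi_prefix {k m : ℕ} (h : k ≤ m) : phi^[k] [false] <+: phi^[m] [false] := by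
  induction m, h using Nat.le_induction with
  | base => exact List.prefix_rfl
  | succ m _ ih => exact ih.trans (iterate_phi_prefix_succ m)

theorem sW_eq_getElem {k i : ℕ} (h : i < (phi^[k] [false]).length) :
    sW i = (phi^[k] [false])[i] := by
  have hi : i < (phi^[i + 1] [false]).length := by
    rw [length_iterate_phi]
    exact (Nat.lt_succ_self i).trans (Nat.lt_pow_self (by norm_num))
  rw [sW, List.getD_eq_getElem _ _ hi]
  rcases le_total k (i + 1) with hk | hk
  · exact ((iterate_phi_prefix hk).getElem h).symm
  · exact (iterate_phi_prefix hk).getElem hi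

theorem sPrefix_eq_take {k n : ℕ} (hn : n ≤ 3 ^ k) : sPrefix n = (phi^[k] [false]).take n := by
  apply List.ext_getElem
  · simp [sPrefix, length_iterate_phi, hn]
  · intro i h₁ h₂
    have hi : i < (phi^[k] [false]).length := by
      rw [List.length_take] at h₂
      omega
    simpa [sPrefix] using sW_eq_getElem hi

/-- For every k ≥ 0, j ≥ 0 and n ≤ 3ᵏ, |qⱼ(n) − qⱼ(3ᵏ − n)| ≤ 1. -/
theorem qj_symmetry (k j n : ℕ) (hn : n ≤ 3 ^ k) :
    |(qj j n : ℤ) - (qj j (3 ^ k - n) : ℤ)| ≤ 1 := by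
  have hpal : (phi^[k] [false]).reverse = phi^[k] [false] := isPal_iterate_phi k
  have hsuffix : sPrefix (3 ^ k - n) = ((phi^[k] [false]).drop n).reverse := by
    rw [List.reverse_drop, hpal, length_iterate_phi, sPrefix_eq_take (Nat.sub_le _ _)]
  have hq : qj j (3 ^ k - n) = PL ((phi^[k] [false]).drop n ++ List.replicate j true) := by
    rw [qj, hsuffix, ← PL_reverse]
    simp
  rw [hq, qj, sPrefix_eq_take hn]
  apply IsPal.abs_PL_sub_PL_le_one
  rw [List.append_assoc, ← List.append_assoc (List.take _ _), List.take_append_drop]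
  simp [IsPal, hpal]
end

section
/- Let S ⊂ X be the set of ternary expansions x with p(x) = q(x). Then S = {ε} ∪ {1 0^*} ∪ (2 2^+ 0 0^+)^* · 2 2^+ · (0^* ∪ 0^+ 1 0^*); that is, p(n) = q(n) if and only if n = 0, n = 3^k for some k, or the ternary expansion of n consists of alternating blocks of at least two 2s and at least two 0s (starting with a 2-block), possibly ending with a single 0 or with 0s followed by 1 0^l. -/
/-- The value of a big-endian ternary digit string. -/
def val3 (x : List ℕ) : ℕ := x.foldl (fun a d => 3 * a + d) 0

/-- The big-endian ternary expansion of n without leading zeros (ε for n = 0). -/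
def exp3 (n : ℕ) : List ℕ := (Nat.digits 3 n).reverse

/-- overline(x): the ternary expansion of 3^|x| − [x]₃ without leading zeros. -/
def ov (x : List ℕ) : List ℕ := exp3 (3 ^ x.length - val3 x)

/-- Tails of the regular expression: 0^* ∪ 0^+ 1 0^*. -/
inductive STail : List ℕ → Prop
  | zeros (l : ℕ) : STail (List.replicate l 0)
  | one (l m : ℕ) : STail (List.replicate (l + 1) 0 ++ 1 :: List.replicate m 0)

/-- The language (2 2^+ 0 0^+)^* · 2 2^+ · (0^* ∪ 0^+ 1 0^*): alternating blocks
of at least two 2s and at least two 0s, starting with a 2-block, ending with a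
tail from 0^* ∪ 0^+ 1 0^*. -/
inductive InS : List ℕ → Prop
  | base (a : ℕ) (t : List ℕ) (ht : STail t) : InS (List.replicate (a + 2) 2 ++ t)
  | step (a z : ℕ) (x : List ℕ) (hx : InS x) :
      InS (List.replicate (a + 2) 2 ++ List.replicate (z + 2) 0 ++ x)


/-! ### Letters of the Sierpinski word -/

theorem phi_getD (w : List Bool) (n : ℕ) :
    (phi w).getD n true = if n % 3 = 1 then true else w.getD (n / 3) true := by
  induction w generalizing n with
  | nil => simp [phi]
  | cons c w ih =>
    have h : phi (c :: w) = c :: true :: c :: phi w := by cases c <;> simp [phi]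
    rw [h]
    match n with
    | 0 => simp
    | 1 => simp
    | 2 => simp
    | n + 3 =>
      have h3 : (n + 3) / 3 = n / 3 + 1 := by omega
      simpa [h3] using ih n

theorem phi_iterate_getD_succ (k n : ℕ) (h : n < 3 ^ k) :
    (phi^[k + 1] [false]).getD n true = (phi^[k] [false]).getD n true := by
  induction k generalizing n with
  | zero =>
    have : n = 0 := by simpa using h
    subst this
    simp [phi]
  | succ k ih =>
    have h3 := ih (n / 3) (by rw [pow_succ] at h; omega)
    rw [Function.iterate_succ_apply', phi_getD, h3, Function.iterate_succ_apply' phi k, phi_getD]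

theorem phi_iterate_getD (k l n : ℕ) (h : n < 3 ^ k) (hl : k ≤ l) :
    (phi^[l] [false]).getD n true = (phi^[k] [false]).getD n true := by
  induction l, hl using Nat.le_induction with
  | base => rfl
  | succ l hl ih =>
    rw [phi_iterate_getD_succ l n (h.trans_le (Nat.pow_le_pow_right (by norm_num) hl)), ih]

theorem sW_zero : sW 0 = false := by simp [sW, phi]

theorem sW_eq (n : ℕ) : sW n = if n % 3 = 1 then true else sW (n / 3) := by
  have h3 : ∀ m : ℕ, m < 3 ^ m := fun m => Nat.lt_pow_self (by norm_num)
  unfold sW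
  rw [Function.iterate_succ_apply', phi_getD]
  rcases Nat.eq_zero_or_pos n with rfl | hn
  · simp [phi]
  · rw [phi_iterate_getD (n / 3 + 1) n (n / 3) (by rw [pow_succ]; have := h3 (n / 3); omega)
      (by omega)]

theorem sW_run (k m : ℕ) (h : m < 3 ^ k) : sW (3 ^ k + m) = true := by
  induction k generalizing m with
  | zero =>
    have : m = 0 := by simpa using h
    subst this
    rw [sW_eq]; simp
  | succ k ih =>
    rw [pow_succ] at *
    rw [sW_eq, show (3 ^ k * 3 + m) / 3 = 3 ^ k + m / 3 by omega, ih _ (by omega)]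
    simp

theorem sW_right (k m : ℕ) (h : m < 3 ^ k) : sW (2 * 3 ^ k + m) = sW m := by
  induction k generalizing m with
  | zero =>
    have : m = 0 := by simpa using h
    subst this
    rw [sW_eq]; simp
  | succ k ih =>
    rw [pow_succ] at *
    rw [sW_eq, sW_eq m, show (2 * (3 ^ k * 3) + m) / 3 = 2 * 3 ^ k + m / 3 by omega,
      ih _ (by omega), show (2 * (3 ^ k * 3) + m) % 3 = m % 3 by omega]

theorem sW_reflect (k x y : ℕ) (h : x + y + 1 = 3 ^ k) : sW x = sW y := by
  induction k generalizing x y with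
  | zero =>
    have : x = 0 ∧ y = 0 := by simpa using h
    rw [this.1, this.2]
  | succ k ih =>
    rw [pow_succ] at h
    rw [sW_eq, sW_eq y, ih (x / 3) (y / 3) (by omega)]
    have : x % 3 = 1 ↔ y % 3 = 1 := by omega
    simp [this]

theorem exists_pow_le_lt {n : ℕ} (h : n ≠ 0) : ∃ k, 3 ^ k ≤ n ∧ n < 3 * 3 ^ k :=
  ⟨Nat.log 3 n, Nat.pow_log_le_self 3 h, by
    have := Nat.lt_pow_succ_log_self (b := 3) (by norm_num) n
    rw [pow_succ] at this; omega⟩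

/-! ### Blocks and palindromes -/

/-- `Blk m c`: the word `φᵐ(a)` occurs at position `c` as the image of a letter `a`. -/
inductive Blk (m : ℕ) : ℕ → Prop
  | zero : Blk m 0
  | right (k c : ℕ) (hc : Blk m c) (h : c + 3 ^ m ≤ 3 ^ k) : Blk m (2 * 3 ^ k + c)

theorem Blk.triple {m c : ℕ} (h : Blk m c) : Blk (m + 1) (3 * c) := by
  induction h with
  | zero => exact Blk.zero
  | right k c hc h ih =>
    have := Blk.right (k + 1) (3 * c) ih (by rw [pow_succ, pow_succ]; omega)
    rwa [show 2 * 3 ^ (k + 1) + 3 * c = 3 * (2 * 3 ^ k + c) by rw [pow_succ]; omega] at this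

theorem blk_of_sW {x : ℕ} (h : sW x = false) : Blk 0 x := by
  induction x using Nat.strong_induction_on with
  | _ x ih =>
    rcases eq_or_ne x 0 with rfl | hx
    · exact Blk.zero
    obtain ⟨k, h1, h2⟩ := exists_pow_le_lt hx
    by_cases h3 : x < 2 * 3 ^ k
    · have := sW_run k (x - 3 ^ k) (by omega)
      rw [show 3 ^ k + (x - 3 ^ k) = x by omega, h] at this
      cases this
    · obtain ⟨m, rfl⟩ := Nat.exists_eq_add_of_le (not_lt.1 h3)
      rw [sW_right k m (by omega)] at h
      exact Blk.right k m (ih m (by omega) h) (by simp; omega)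

theorem Blk.eq_zero_or_le {m c : ℕ} (h : Blk m c) : c = 0 ∨ 2 * 3 ^ m ≤ c := by
  cases h with
  | zero => exact Or.inl rfl
  | right k c hc h => exact Or.inr (by omega)

theorem Blk.reflect {m c k d : ℕ} (h : Blk m c) (hk : c + 3 ^ m + d = 3 ^ k) : Blk m d := by
  induction k generalizing c d with
  | zero =>
    have := Nat.pow_pos (n := m) (show 0 < 3 by norm_num)
    obtain rfl : d = 0 := by simp at hk; omega
    exact Blk.zero
  | succ k ih =>
    have hp := pow_succ 3 k
    by_cases h1 : c + 3 ^ m ≤ 3 ^ k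
    · have := Blk.right k (3 ^ k - (c + 3 ^ m)) (ih h (by omega)) (by omega)
      rwa [show 2 * 3 ^ k + (3 ^ k - (c + 3 ^ m)) = d by omega] at this
    · cases h with
      | zero =>
        have h2 : k < m := (Nat.pow_lt_pow_iff_right (a := 3) (by norm_num)).1 (by omega)
        have h3 : 3 ^ (k + 1) ≤ 3 ^ m := Nat.pow_le_pow_right (by norm_num) h2
        obtain rfl : d = 0 := by omega
        exact Blk.zero
      | right j c hc h =>
        have h2 : j < k + 1 := (Nat.pow_lt_pow_iff_right (a := 3) (by norm_num)).1 (by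
          have : 0 < 3 ^ j := by positivity
          have : 0 < 3 ^ m := by positivity
          omega)
        have h3 : k ≤ j := by
          by_contra! h4
          have : 3 ^ (j + 1) ≤ 3 ^ k := Nat.pow_le_pow_right (by norm_num) h4
          rw [pow_succ] at this
          omega
        obtain rfl : j = k := by omega
        exact ih hc (by omega)

/-- The factor of `w` on positions `[i, n)` is a palindrome. -/
def PalOn (w : ℕ → Bool) (i n : ℕ) : Prop :=
  ∀ x y, i ≤ x → i ≤ y → x + y + 1 = i + n → w x = w y

theorem palOn_sW_classify {i n : ℕ} (h : PalOn sW i n)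
    (ha : ∃ x, i ≤ x ∧ x < n ∧ sW x = false) :
    ∃ m c, Blk m c ∧ i + n = 2 * c + 3 ^ m ∧ c ≤ i + 3 ^ m := by
  have b1 : ∀ x, x % 3 = 1 → sW x = true := fun x hx => by rw [sW_eq, if_pos hx]
  have b2 : ∀ x, x % 3 ≠ 1 → sW x = sW (x / 3) := fun x hx => by rw [sW_eq, if_neg hx]
  induction n using Nat.strong_induction_on generalizing i with
  | _ n ih =>
    obtain ⟨x, hix, hxn, hx⟩ := ha
    have hy := h x (i + n - 1 - x) hix (by omega) (by omega)
    generalize hyd : i + n - 1 - x = y at hy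
    rw [hx] at hy
    wlog hxy : x ≤ y generalizing x y
    · exact this y (by omega) (by omega) hy.symm x (by omega) hx.symm (by omega)
    have hx1 : x % 3 ≠ 1 := fun h' => by simp [b1 x h'] at hx
    have hy1 : y % 3 ≠ 1 := fun h' => by simp [b1 y h'] at hy
    by_cases hs : (i + n) % 3 = 0
    · have hp : PalOn sW (i / 3) ((n + 2) / 3) := by
        intro u v hu hv huv
        by_cases hiu : i ≤ 3 * u
        · have := h (3 * u) (3 * v + 2) hiu (by omega) (by omega)
          rw [b2 _ (by omega), b2 (3 * v + 2) (by omega)] at this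
          rwa [show 3 * u / 3 = u by omega, show (3 * v + 2) / 3 = v by omega] at this
        · have := h (3 * u + 2) (3 * v) (by omega) (by omega) (by omega)
          rw [b2 _ (by omega), b2 (3 * v) (by omega)] at this
          rwa [show 3 * v / 3 = v by omega, show (3 * u + 2) / 3 = u by omega] at this
      obtain ⟨m, c, hb, h1, h2⟩ := ih ((n + 2) / 3) (by omega) hp
        ⟨x / 3, by omega, by omega, by rw [← b2 x hx1, hx]⟩
      exact ⟨m + 1, 3 * c, hb.triple, by rw [pow_succ]; omega, by rw [pow_succ]; omega⟩
    · have key : x = y ∧ x ≤ i + 1 := by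
        by_contra hcon
        rcases (by omega : x % 3 = 0 ∨ x % 3 = 2) with h0 | h2
        · have h3 := h (x + 2) (y - 2) (by omega) (by omega) (by omega)
          rw [b2 (x + 2) (by omega), b1 (y - 2) (by omega),
            show (x + 2) / 3 = x / 3 by omega, ← b2 x hx1, hx] at h3
          cases h3
        · have h3 := h (x + 2) (y - 2) (by omega) (by omega) (by omega)
          rw [b1 (x + 2) (by omega), b2 (y - 2) (by omega),
            show (y - 2) / 3 = y / 3 by omega, ← b2 y hy1, ← hy] at h3
          cases h3
      exact ⟨0, x, blk_of_sW hx, by simp; omega, by simp; omega⟩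

/-! ### Closed recurrences -/

/-- The pair of candidate values for `(p(n), q(n))`, given by recursion on the leading digit. -/
def PQ (n : ℕ) : ℕ × ℕ :=
  if n = 0 then (0, 0)
  else if n < 2 * 3 ^ Nat.log 3 n then (if n = 3 ^ Nat.log 3 n then 1 else 2, 1)
  else
    (min (1 + (PQ (3 ^ Nat.log 3 n - (n - 2 * 3 ^ Nat.log 3 n))).1)
        (2 + (PQ (n - 2 * 3 ^ Nat.log 3 n)).2),
      1 + min (PQ (n - 2 * 3 ^ Nat.log 3 n)).2
        (PQ (3 ^ Nat.log 3 n - (n - 2 * 3 ^ Nat.log 3 n))).2)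
termination_by n
decreasing_by
  all_goals
    have : 0 < 3 ^ Nat.log 3 n := by positivity
    omega

theorem PQ_zero : PQ 0 = (0, 0) := by rw [PQ]; simp

theorem log_three_eq {n k : ℕ} (h1 : 3 ^ k ≤ n) (h2 : n < 3 * 3 ^ k) : Nat.log 3 n = k :=
  (Nat.log_eq_iff (by right; have : 0 < 3 ^ k := by positivity
                      omega)).2 ⟨h1, by rw [pow_succ]; omega⟩

theorem PQ_pow (k : ℕ) : PQ (3 ^ k) = (1, 1) := by
  have : 0 < 3 ^ k := by positivity
  rw [PQ, log_three_eq le_rfl (by omega), if_neg (by omega), if_pos (by omega), if_pos rfl]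

theorem PQ_right (k m : ℕ) (h : m ≤ 3 ^ k) :
    PQ (2 * 3 ^ k + m) =
      (min (1 + (PQ (3 ^ k - m)).1) (2 + (PQ m).2), 1 + min (PQ m).2 (PQ (3 ^ k - m)).2) := by
  have : 0 < 3 ^ k := by positivity
  rcases h.lt_or_eq with h | rfl
  · rw [PQ, log_three_eq (k := k) (by omega) (by omega), if_neg (by omega), if_neg (by omega),
      show 2 * 3 ^ k + m - 2 * 3 ^ k = m by omega]
  · rw [show 2 * 3 ^ k + 3 ^ k = 3 ^ (k + 1) by rw [pow_succ]; omega, PQ_pow, PQ_pow, Nat.sub_self,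
      PQ_zero]
    rfl

theorem PQ_run (k m : ℕ) (h0 : 0 < m) (h : m ≤ 3 ^ k) : PQ (3 ^ k + m) = (2, 1) := by
  rcases h.lt_or_eq with h | rfl
  · rw [PQ, log_three_eq (k := k) (by omega) (by omega), if_neg (by omega), if_pos (by omega),
      if_neg (by omega)]
  · rw [show 3 ^ k + 3 ^ k = 2 * 3 ^ k + 0 by omega, PQ_right k 0 (by omega), Nat.sub_zero, PQ_pow,
      PQ_zero]
    rfl

theorem PQ_run_bounds (k n : ℕ) (h1 : 3 ^ k ≤ n) (h2 : n ≤ 2 * 3 ^ k) :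
    1 ≤ (PQ n).1 ∧ (PQ n).1 ≤ 2 ∧ (PQ n).2 = 1 := by
  obtain ⟨m, rfl⟩ := Nat.exists_eq_add_of_le h1
  rcases Nat.eq_zero_or_pos m with rfl | hm
  · rw [Nat.add_zero, PQ_pow]; simp
  · rw [PQ_run k m hm (by omega)]; simp

/-- Both candidate values differ by at most one at the positions `i` and `n`. -/
def Close (i n : ℕ) : Prop :=
  (PQ i).1 ≤ (PQ n).1 + 1 ∧ (PQ n).1 ≤ (PQ i).1 + 1 ∧
    (PQ i).2 ≤ (PQ n).2 + 1 ∧ (PQ n).2 ≤ (PQ i).2 + 1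

theorem Close.symm {i n : ℕ} (h : Close i n) : Close n i := ⟨h.2.1, h.1, h.2.2.2, h.2.2.1⟩

theorem close_of_run {k l i n : ℕ} (h1 : 3 ^ k ≤ i) (h2 : i ≤ 2 * 3 ^ k) (h3 : 3 ^ l ≤ n)
    (h4 : n ≤ 2 * 3 ^ l) : Close i n := by
  have := PQ_run_bounds k i h1 h2
  have := PQ_run_bounds l n h3 h4
  unfold Close
  omega

theorem PQ_reflect (k x y : ℕ) (h : x + y = 3 ^ k) :
    Close x y ∧ (PQ x).1 ≤ (PQ x).2 + 2 ∧ (PQ y).1 ≤ (PQ y).2 + 2 := by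
  induction k generalizing x y with
  | zero =>
    have h1 := PQ_pow 0
    rw [pow_zero] at h1 h
    have : (x = 0 ∧ y = 1) ∨ (x = 1 ∧ y = 0) := by omega
    rcases this with ⟨rfl, rfl⟩ | ⟨rfl, rfl⟩ <;> simp [Close, h1, PQ_zero]
  | succ k ih =>
    wlog hxy : x ≤ y generalizing x y
    · have := this y x (by omega) (by omega)
      exact ⟨this.1.symm, this.2.2, this.2.1⟩
    rw [pow_succ] at h
    by_cases hx : x ≤ 3 ^ k
    · have h1 := ih x (3 ^ k - x) (by omega)
      obtain rfl : y = 2 * 3 ^ k + (3 ^ k - x) := by omega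
      unfold Close at *
      rw [PQ_right k _ (by omega), show 3 ^ k - (3 ^ k - x) = x by omega]
      dsimp only
      omega
    · have h1 := close_of_run (k := k) (l := k) (i := x) (n := y) (by omega) (by omega) (by omega)
        (by omega)
      have := PQ_run_bounds k x (by omega) (by omega)
      have := PQ_run_bounds k y (by omega) (by omega)
      exact ⟨h1, by omega, by omega⟩

theorem close_right {k i n : ℕ} (hi : i ≤ 3 ^ k) (hn : n ≤ 3 ^ k) (h : Close i n)
    (h' : Close (3 ^ k - i) (3 ^ k - n)) : Close (2 * 3 ^ k + i) (2 * 3 ^ k + n) := by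
  unfold Close at *
  rw [PQ_right k i hi, PQ_right k n hn]
  dsimp only
  omega

theorem close_of_blk (k : ℕ) {m c i n : ℕ} (hb : Blk m c) (hk : c + 3 ^ m ≤ 3 ^ k)
    (hs : i + n = 2 * c + 3 ^ m) (hc : c ≤ i + 3 ^ m) (hin : i ≤ n) : Close i n := by
  induction k using Nat.strong_induction_on generalizing c i n with
  | _ k ih =>
    have hb' := hb
    cases hb' with
    | zero => exact (PQ_reflect m i n (by omega)).1
    | right j c hcb h =>
      have hm := Nat.pow_pos (n := m) (show 0 < 3 by norm_num)
      have hjk : j < k := (Nat.pow_lt_pow_iff_right (a := 3) (by norm_num)).1 (by omega)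
      have hp := pow_succ 3 j
      have hb' := hcb.reflect (d := 3 ^ j - (c + 3 ^ m)) (k := j) (by omega)
      have hc0 := hcb.eq_zero_or_le
      have hd0 := hb'.eq_zero_or_le
      by_cases hi : i < 2 * 3 ^ j
      · by_cases hn : n ≤ 3 * 3 ^ j
        · have b2 : 1 ≤ (PQ n).1 ∧ (PQ n).1 ≤ 3 ∧ 1 ≤ (PQ n).2 ∧ (PQ n).2 ≤ 2 := by
            obtain ⟨n', rfl⟩ := Nat.exists_eq_add_of_le (show 2 * 3 ^ j ≤ n by omega)
            have b3 := PQ_run_bounds m n' (by omega) (by omega)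
            rw [PQ_right j n' (by omega)]
            dsimp only
            omega
          have b3 := PQ_run j (i - 3 ^ j) (by omega) (by omega)
          rw [show 3 ^ j + (i - 3 ^ j) = i by omega] at b3
          unfold Close
          rw [b3] at *
          dsimp only at *
          omega
        · exact close_of_run (k := j) (l := j + 1) (by omega) (by omega) (by omega) (by omega)
      · by_cases hn : n ≤ 3 * 3 ^ j
        · obtain ⟨i, rfl⟩ := Nat.exists_eq_add_of_le (not_lt.1 hi)
          obtain ⟨n, rfl⟩ := Nat.exists_eq_add_of_le (show 2 * 3 ^ j ≤ n by omega)
          refine close_right (by omega) (by omega)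
            (ih j hjk hcb h (by omega) (by omega) (by omega)) ?_
          exact (ih j hjk hb' (by omega)
            (by omega) (by omega) (by omega)).symm
        · have b2 : 1 ≤ (PQ i).1 ∧ (PQ i).1 ≤ 3 ∧ 1 ≤ (PQ i).2 ∧ (PQ i).2 ≤ 2 := by
            by_cases hi' : i < 2 * 3 ^ j
            · have b3 := PQ_run_bounds j i (by omega) (by omega)
              omega
            obtain ⟨i', rfl⟩ := Nat.exists_eq_add_of_le (not_lt.1 hi')
            have b3 := PQ_run_bounds m (3 ^ j - i') (by omega) (by omega)
            rw [PQ_right j i' (by omega)]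
            dsimp only
            omega
          have b3 := PQ_run (j + 1) (n - 3 ^ (j + 1)) (by omega) (by omega)
          rw [show 3 ^ (j + 1) + (n - 3 ^ (j + 1)) = n by omega] at b3
          unfold Close
          rw [b3] at *
          dsimp only at *
          omega

theorem close_of_no_a {i n : ℕ} (hin : i < n) (h : ∀ x, i ≤ x → x < n → sW x = true) :
    Close i n := by
  have key : ∀ k i n, i < n → n ≤ 3 ^ k → (∀ x, i ≤ x → x < n → sW x = true) → Close i n := by
    intro k
    induction k with
    | zero =>
      intro i n hin hn h
      obtain rfl : i = 0 := by simp at hn; omega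
      have := h 0 le_rfl hin
      rw [sW_zero] at this
      cases this
    | succ k ih =>
      intro i n hin hn h
      rw [pow_succ] at hn
      have hk : 0 < 3 ^ k := by positivity
      have e1 : sW (3 ^ k - 1) = false := by
        rw [sW_reflect k (3 ^ k - 1) 0 (by omega), sW_zero]
      have e2 : sW (2 * 3 ^ k) = false := by
        have := sW_right k 0 (by omega)
        rwa [Nat.add_zero, sW_zero] at this
      by_cases h1 : n ≤ 3 ^ k
      · exact ih i n hin h1 h
      have h2 : 3 ^ k ≤ i := by
        by_contra! h2
        have := h (3 ^ k - 1) (by omega) (by omega)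
        rw [e1] at this
        cases this
      by_cases h3 : n ≤ 2 * 3 ^ k
      · exact close_of_run h2 (by omega) (by omega) h3
      have h4 : 2 * 3 ^ k ≤ i := by
        by_contra! h4
        have := h (2 * 3 ^ k) (by omega) (by omega)
        rw [e2] at this
        cases this
      obtain ⟨i, rfl⟩ := Nat.exists_eq_add_of_le h4
      obtain ⟨n, rfl⟩ := Nat.exists_eq_add_of_le (show 2 * 3 ^ k ≤ n by omega)
      have h5 : ∀ x, i ≤ x → x < n → sW x = true := by
        intro x hx hx'
        rw [← sW_right k x (by omega)]
        exact h _ (by omega) (by omega)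
      refine close_right (by omega) (by omega) (ih i n (by omega) (by omega) h5) ?_
      refine (ih _ _ (by omega) (by omega) fun x hx hx' => ?_).symm
      rw [sW_reflect k x (3 ^ k - 1 - x) (by omega)]
      exact h5 _ (by omega) (by omega)
  exact key n i n hin (Nat.lt_pow_self (by norm_num)).le h

theorem close_of_palOn {i n : ℕ} (hin : i ≤ n) (h : PalOn sW i n) : Close i n := by
  rcases hin.eq_or_lt with rfl | hin
  · simp [Close]
  by_cases ha : ∃ x, i ≤ x ∧ x < n ∧ sW x = false
  · obtain ⟨m, c, hb, h1, h2⟩ := palOn_sW_classify h ha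
    exact close_of_blk _ hb (Nat.lt_pow_self (by norm_num)).le h1 h2 hin.le
  · refine close_of_no_a hin fun x hx hx' => ?_
    by_contra hc
    exact ha ⟨x, hx, hx', by simpa using hc⟩

/-! ### Palindromic length -/

theorem PL_le_of_flatten {α : Type*} {w : List α} (l : List (List α)) (hl : ∀ p ∈ l, IsPal p)
    (hw : l.flatten = w) : PL w ≤ l.length :=
  Nat.sInf_le ⟨l, rfl, hl, hw⟩

theorem exists_palindromes {α : Type*} (w : List α) :
    ∃ l : List (List α), l.length = PL w ∧ (∀ p ∈ l, IsPal p) ∧ l.flatten = w := by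
  refine Nat.sInf_mem (s := {k | ∃ l : List (List α), l.length = k ∧ (∀ p ∈ l, IsPal p) ∧
    l.flatten = w}) ⟨_, w.map fun a => [a], rfl, ?_, ?_⟩
  · intro p hp
    obtain ⟨a, -, rfl⟩ := List.mem_map.1 hp
    simp [IsPal]
  · induction w with
    | nil => rfl
    | cons a w ih => simpa using ih

theorem PL_append_le {α : Type*} (u v : List α) : PL (u ++ v) ≤ PL u + PL v := by
  obtain ⟨l, h1, h2, h3⟩ := exists_palindromes u
  obtain ⟨l', h1', h2', h3'⟩ := exists_palindromes v
  rw [← h1, ← h1', ← List.length_append]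
  refine PL_le_of_flatten (l ++ l') (fun p hp => ?_) (by simp [h3, h3'])
  rcases List.mem_append.1 hp with hp | hp
  exacts [h2 p hp, h2' p hp]

theorem PL_le_one {α : Type*} {w : List α} (h : IsPal w) : PL w ≤ 1 :=
  PL_le_of_flatten [w] (by simpa using h) (by simp)

theorem PL_nil {α : Type*} : PL ([] : List α) = 0 :=
  Nat.le_zero.1 (PL_le_of_flatten [] (by simp) rfl)

theorem le_PL_of_palOn {w : ℕ → Bool} {f : ℕ → ℕ} (h0 : f 0 = 0)
    (hf : ∀ i n, i ≤ n → PalOn w i n → f n ≤ f i + 1) (n : ℕ) :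
    f n ≤ PL ((List.range n).map w) := by
  obtain ⟨l, h1, h2, h3⟩ := exists_palindromes ((List.range n).map w)
  rw [← h1]
  clear h1
  induction l using List.reverseRecOn generalizing n with
  | nil =>
    have : n = 0 := by
      have := congrArg List.length h3
      simpa using this.symm
    simp [this, h0]
  | append_singleton l p ih =>
    rw [List.flatten_append, List.flatten_singleton] at h3
    have hlen := congrArg List.length h3
    rw [List.length_append, List.length_map, List.length_range] at hlen
    have hl : l.flatten = (List.range l.flatten.length).map w := by
      have := congrArg (List.take l.flatten.length) h3
      rw [List.take_left, ← List.map_take, List.take_range, min_eq_left (by omega)] at this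
      exact this
    have hp : p = ((List.range n).map w).drop l.flatten.length := by
      rw [← h3, List.drop_left]
    have ih' := ih l.flatten.length (fun p hp => h2 p (List.mem_append_left _ hp)) hl
    generalize l.flatten.length = i at *
    have hpal : PalOn w i n := by
      intro x y hx hy hxy
      have hr : p.reverse = p := h2 p (by simp)
      have e1 : p[x - i]? = some (w x) := by
        rw [hp, List.getElem?_drop, show i + (x - i) = x by omega, List.getElem?_map,
          List.getElem?_range (by omega)]
        rfl
      have e2 : p.reverse[x - i]? = some (w y) := by
        rw [List.getElem?_reverse (by omega), hp, List.getElem?_drop, ← hp,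
          show i + (p.length - 1 - (x - i)) = y by omega, List.getElem?_map,
          List.getElem?_range (by omega)]
        rfl
      rw [hr, e1] at e2
      simpa using e2
    have := hf i n (by omega) hpal
    simp only [List.length_append, List.length_singleton]
    omega

theorem replicate_append_sPrefix (j n : ℕ) :
    List.replicate j true ++ sPrefix n =
      (List.range (j + n)).map fun x => if x < j then true else sW (x - j) := by
  refine List.ext_getElem (by simp [sPrefix]) fun x h1 h2 => ?_
  rw [List.getElem_append]
  split
  · next h => simp at h; simp [h]
  · next h => simp at h; simp [sPrefix, h]

theorem PQ_fst_le_pS (n : ℕ) : (PQ n).1 ≤ pS n :=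
  le_PL_of_palOn (f := fun n => (PQ n).1) (by rw [PQ_zero])
    (fun _ _ hin h => (close_of_palOn hin h).2.1) n

theorem PQ_snd_le_qj (j n : ℕ) : (PQ n).2 ≤ qj j n := by
  have key := le_PL_of_palOn (w := fun x => if x < j then true else sW (x - j))
    (f := fun n => (PQ (n - j)).2) (by rw [Nat.zero_sub, PQ_zero]) ?_ (j + n)
  · rwa [← replicate_append_sPrefix, Nat.add_sub_cancel_left] at key
  intro i n hin h
  by_cases hn : n ≤ j
  · rw [Nat.sub_eq_zero_of_le hn, PQ_zero]
    exact Nat.zero_le _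
  by_cases hi : j ≤ i
  · refine (close_of_palOn (by omega) fun x y hx hy hxy => ?_).2.2.2
    have := h (x + j) (y + j) (by omega) (by omega) (by omega)
    simpa using this
  suffices hs : (PQ (n - j)).2 = 1 by omega
  have e1 := h j (i + n - 1 - j) (by omega) (by omega) (by omega)
  simp only [lt_irrefl, if_false, Nat.sub_self, sW_zero] at e1
  have e2 : j ≤ i + n - 1 - j := by
    by_contra! hc
    rw [if_pos hc] at e1
    cases e1
  have hpre : PalOn sW 0 (i + n - 2 * j) := by
    intro x y _ _ hxy
    have := h (x + j) (y + j) (by omega) (by omega) (by omega)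
    simpa using this
  obtain ⟨m, c, hb, h1, h2⟩ := palOn_sW_classify hpre ⟨0, le_rfl, by omega, sW_zero⟩
  have hm : 0 < 3 ^ m := by positivity
  have h0 := hb.eq_zero_or_le
  have e3 : n - j ≤ 2 * 3 ^ m := by
    by_contra! hc
    have e4 := h (j + 2 * 3 ^ m) (j - 1 - 3 ^ m) (by omega) (by omega) (by omega)
    dsimp only at e4
    rw [if_neg (by omega), if_pos (by omega), Nat.add_sub_cancel_left] at e4
    have e5 := sW_right m 0 hm
    rw [Nat.add_zero, sW_zero, e4] at e5
    cases e5
  exact (PQ_run_bounds m (n - j) (by omega) e3).2.2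

theorem sPrefix_add (m n : ℕ) :
    sPrefix (m + n) = sPrefix m ++ (List.range n).map fun x => sW (m + x) := by
  simp [sPrefix, List.range_add]

theorem isPal_replicate {α : Type*} (j : ℕ) (a : α) : IsPal (List.replicate j a) :=
  List.reverse_replicate

theorem isPal_sPrefix_pow (k : ℕ) : IsPal (sPrefix (3 ^ k)) := by
  refine List.ext_getElem (by simp) fun x h1 h2 => ?_
  simp only [sPrefix, List.length_reverse, List.length_map, List.length_range] at h1
  simp only [sPrefix, List.getElem_reverse, List.getElem_map, List.getElem_range, List.length_map,
    List.length_range]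
  exact sW_reflect k _ _ (by omega)

theorem sPrefix_run (k m : ℕ) (h : m ≤ 3 ^ k) :
    sPrefix (3 ^ k + m) = sPrefix (3 ^ k) ++ List.replicate m true := by
  rw [sPrefix_add]
  congr 1
  refine List.ext_getElem (by simp) fun x h1 h2 => ?_
  simp at h1
  simpa using sW_run k x (by omega)

theorem sPrefix_right (k m : ℕ) (h : m ≤ 3 ^ k) :
    sPrefix (2 * 3 ^ k + m) = sPrefix (3 ^ k) ++ List.replicate (3 ^ k) true ++ sPrefix m := by
  rw [sPrefix_add, ← sPrefix_run k _ le_rfl, two_mul]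
  congr 1
  refine List.ext_getElem (by simp [sPrefix]) fun x h1 h2 => ?_
  simp at h1
  have := sW_right k x (by omega)
  simpa [sPrefix, two_mul] using this

theorem exists_pal_sPrefix_right (k m : ℕ) (h : m ≤ 3 ^ k) :
    ∃ v, IsPal v ∧ sPrefix (2 * 3 ^ k + m) = sPrefix (3 ^ k - m) ++ v := by
  have h1 := sPrefix_add (3 ^ k - m) m
  rw [Nat.sub_add_cancel h] at h1
  have h2 := sPrefix_add m (3 ^ k - m)
  rw [Nat.add_sub_cancel' h] at h2
  set v := (List.range m).map fun x => sW (3 ^ k - m + x)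
  have h3 : sPrefix m = v.reverse := by
    have h4 : (sPrefix (3 ^ k)).reverse = sPrefix (3 ^ k) := isPal_sPrefix_pow k
    rw [h2, ← h2, h1, List.reverse_append, ← h1, h2] at h4
    exact (List.append_inj_left h4 (by simp [v, sPrefix])).symm
  refine ⟨v ++ List.replicate (3 ^ k) true ++ v.reverse, by simp [IsPal], ?_⟩
  rw [sPrefix_right k m h, h1, h3]
  simp

theorem exists_qj_le (k n : ℕ) (h : n ≤ 3 ^ k) : ∃ j ≤ 3 ^ k, qj j n ≤ (PQ n).2 := by
  induction k generalizing n with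
  | zero =>
    refine ⟨0, by simp, ?_⟩
    have : n = 0 ∨ n = 1 := by simp at h; omega
    rcases this with rfl | rfl
    · simp [qj, sPrefix, PL_nil]
    · have := PQ_pow 0
      rw [pow_zero] at this
      rw [this]
      exact PL_le_one (by simp [IsPal, sPrefix])
  | succ k ih =>
    rw [pow_succ] at *
    by_cases h1 : n ≤ 3 ^ k
    · obtain ⟨j, hj, hq⟩ := ih n h1
      exact ⟨j, by omega, hq⟩
    by_cases h2 : n ≤ 2 * 3 ^ k
    · obtain ⟨m, rfl⟩ := Nat.exists_eq_add_of_le (show 3 ^ k ≤ n by omega)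
      refine ⟨m, by omega, ?_⟩
      rw [PQ_run k m (by omega) (by omega)]
      refine PL_le_one ?_
      have h4 : (sPrefix (3 ^ k)).reverse = sPrefix (3 ^ k) := isPal_sPrefix_pow k
      rw [sPrefix_run k m (by omega)]
      simp [IsPal, h4]
    obtain ⟨m, rfl⟩ := Nat.exists_eq_add_of_le (show 2 * 3 ^ k ≤ n by omega)
    rw [PQ_right k m (by omega)]
    dsimp only
    rcases le_total (PQ m).2 (PQ (3 ^ k - m)).2 with hle | hle
    · rw [min_eq_left hle]
      obtain ⟨j, hj, hq⟩ := ih m (by omega)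
      refine ⟨3 ^ k - j, by omega, ?_⟩
      have h4 : (sPrefix (3 ^ k)).reverse = sPrefix (3 ^ k) := isPal_sPrefix_pow k
      have e : List.replicate (3 ^ k - j) true ++ sPrefix (2 * 3 ^ k + m) =
          (List.replicate (3 ^ k - j) true ++ sPrefix (3 ^ k) ++
            List.replicate (3 ^ k - j) true) ++ (List.replicate j true ++ sPrefix m) := by
        have er : List.replicate (3 ^ k) true =
            List.replicate (3 ^ k - j) true ++ List.replicate j true := by
          rw [← List.replicate_add, Nat.sub_add_cancel hj]
        rw [sPrefix_right k m (by omega), er]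
        simp only [List.append_assoc]
      have := PL_append_le (List.replicate (3 ^ k - j) true ++ sPrefix (3 ^ k) ++
        List.replicate (3 ^ k - j) true) (List.replicate j true ++ sPrefix m)
      have := PL_le_one (w := List.replicate (3 ^ k - j) true ++ sPrefix (3 ^ k) ++
        List.replicate (3 ^ k - j) true) (by simp [IsPal, h4])
      unfold qj at *
      rw [e]
      omega
    · rw [min_eq_right hle]
      obtain ⟨j, hj, hq⟩ := ih (3 ^ k - m) (by omega)
      refine ⟨j, by omega, ?_⟩
      obtain ⟨v, hv, e⟩ := exists_pal_sPrefix_right k m (by omega)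
      have := PL_append_le (List.replicate j true ++ sPrefix (3 ^ k - m)) v
      have := PL_le_one hv
      unfold qj at *
      rw [e, ← List.append_assoc]
      omega

theorem qS_eq (n : ℕ) : qS n = (PQ n).2 := by
  refine le_antisymm ?_ ?_
  · obtain ⟨j, -, hj⟩ := exists_qj_le n n (Nat.lt_pow_self (by norm_num)).le
    exact (Nat.sInf_le (Set.mem_range_self j)).trans hj
  · refine le_csInf (Set.range_nonempty _) ?_
    rintro _ ⟨j, rfl⟩
    exact PQ_snd_le_qj j n

theorem pS_le (n : ℕ) : pS n ≤ (PQ n).1 := by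
  induction n using Nat.strong_induction_on with
  | _ n ih =>
    rcases eq_or_ne n 0 with rfl | hn
    · simp [pS, sPrefix, PL_nil]
    obtain ⟨k, h1, h2⟩ := exists_pow_le_lt hn
    have hk := PL_le_one (isPal_sPrefix_pow k)
    by_cases h3 : n < 2 * 3 ^ k
    · obtain ⟨m, rfl⟩ := Nat.exists_eq_add_of_le h1
      rcases Nat.eq_zero_or_pos m with rfl | hm
      · rw [Nat.add_zero, PQ_pow]
        exact hk
      · rw [PQ_run k m hm (by omega), pS, sPrefix_run k m (by omega)]
        have := PL_append_le (sPrefix (3 ^ k)) (List.replicate m true)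
        have := PL_le_one (isPal_replicate m true)
        dsimp only
        omega
    · obtain ⟨m, rfl⟩ := Nat.exists_eq_add_of_le (not_lt.1 h3)
      rw [PQ_right k m (by omega)]
      refine le_min ?_ ?_
      · obtain ⟨v, hv, e⟩ := exists_pal_sPrefix_right k m (by omega)
        have := ih (3 ^ k - m) (by omega)
        have := PL_append_le (sPrefix (3 ^ k - m)) v
        have := PL_le_one hv
        unfold pS at *
        rw [e]
        omega
      · obtain ⟨j, hj, hq⟩ := exists_qj_le k m (by omega)
        have e : sPrefix (2 * 3 ^ k + m) = (sPrefix (3 ^ k) ++ List.replicate (3 ^ k - j) true) ++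
            (List.replicate j true ++ sPrefix m) := by
          have er : List.replicate (3 ^ k) true =
              List.replicate (3 ^ k - j) true ++ List.replicate j true := by
            rw [← List.replicate_add, Nat.sub_add_cancel hj]
          rw [sPrefix_right k m (by omega), er]
          simp only [List.append_assoc]
        have := PL_append_le (sPrefix (3 ^ k) ++ List.replicate (3 ^ k - j) true)
          (List.replicate j true ++ sPrefix m)
        have := PL_append_le (sPrefix (3 ^ k)) (List.replicate (3 ^ k - j) true)
        have := PL_le_one (isPal_replicate (3 ^ k - j) true)
        unfold pS qj at *
        rw [e]
        omega

theorem pS_eq (n : ℕ) : pS n = (PQ n).1 := le_antisymm (pS_le n) (PQ_fst_le_pS n)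

/-! ### The automaton reading ternary expansions -/

/-- States of an automaton reading ternary digits from the least significant one. -/
inductive AutState
  | zero | one | zeroOne | two | twos | trap

/-- Transition of the automaton. -/
def autStep : ℕ → AutState → AutState
  | 0, .zero => .zero
  | 1, .zero => .one
  | 2, .zero => .two
  | 0, .one => .zeroOne
  | 0, .zeroOne => .zeroOne
  | 2, .zeroOne => .two
  | 2, .two => .twos
  | 0, .twos => .one
  | 2, .twos => .twos
  | _, _ => .trap

/-- The state reached after reading a big-endian digit string from its last digit. -/
def aut (x : List ℕ) : AutState := x.foldr autStep .zero

/-- The relation between the values of `p` and `q` at `m` and `3ᵏ - m` recorded by a state. -/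
def AutState.Holds : AutState → ℕ → ℕ → Prop
  | .zero, m, m' => m = 0 ∧ PQ m = (0, 0) ∧ PQ m' = (1, 1)
  | .one, m, m' => 0 < m ∧ (PQ m).1 = (PQ m).2 ∧ (PQ m').1 = (PQ m').2 + 1 ∧ (PQ m').2 = (PQ m).2
  | .zeroOne, m, m' =>
    0 < m ∧ (PQ m).1 = (PQ m).2 ∧ (PQ m').1 = (PQ m').2 ∧ (PQ m').2 = (PQ m).2 + 1
  | .two, m, m' => 0 < m ∧ (PQ m).1 = (PQ m).2 + 1 ∧ (PQ m').1 = (PQ m').2 ∧ (PQ m').2 = (PQ m).2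
  | .twos, m, m' => 0 < m ∧ (PQ m).1 = (PQ m).2 ∧ (PQ m').1 = (PQ m').2 ∧ (PQ m').2 + 1 = (PQ m).2
  | .trap, m, m' => 0 < m ∧ (PQ m).1 = (PQ m).2 + 1 ∧ (PQ m').1 = (PQ m').2 + 1 ∧
    (PQ m).2 ≤ (PQ m').2 + 1 ∧ (PQ m').2 ≤ (PQ m).2 + 1

theorem AutState.Holds.step {s : AutState} {k m d : ℕ} (hm : m < 3 ^ k) (hd : d < 3)
    (h : s.Holds m (3 ^ k - m)) :
    (autStep d s).Holds (d * 3 ^ k + m) (3 ^ (k + 1) - (d * 3 ^ k + m)) := by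
  rw [pow_succ]
  interval_cases d
  · have e := PQ_right k (3 ^ k - m) (by omega)
    rw [show 2 * 3 ^ k + (3 ^ k - m) = 3 ^ k * 3 - (0 * 3 ^ k + m) by omega,
      show 3 ^ k - (3 ^ k - m) = m by omega] at e
    rw [show 0 * 3 ^ k + m = m by omega] at *
    cases s <;> simp only [autStep, AutState.Holds, e, Prod.ext_iff] at h ⊢ <;> omega
  · have e2 : PQ (3 ^ k * 3 - (3 ^ k + m)) = (2, 1) := by
      rw [show 3 ^ k * 3 - (3 ^ k + m) = 3 ^ k + (3 ^ k - m) by omega,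
        PQ_run k _ (by omega) (by omega)]
    rw [one_mul]
    cases s with
    | zero =>
      obtain rfl : m = 0 := h.1
      refine ⟨by omega, ?_⟩
      rw [e2, Nat.add_zero, PQ_pow]
      exact ⟨rfl, rfl, rfl⟩
    | _ =>
      have h0 : 0 < m := h.1
      refine ⟨by omega, ?_⟩
      rw [PQ_run k m h0 hm.le, e2]
      exact ⟨rfl, rfl, by norm_num, by norm_num⟩
  · have e := PQ_right k m (by omega)
    rw [show 3 ^ k * 3 - (2 * 3 ^ k + m) = 3 ^ k - m by omega]
    cases s <;> simp only [autStep, AutState.Holds, e, Prod.ext_iff] at h ⊢ <;> omega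

theorem val3_cons (d : ℕ) (x : List ℕ) : val3 (d :: x) = d * 3 ^ x.length + val3 x := by
  have key : ∀ (x : List ℕ) (a : ℕ),
      x.foldl (fun a d => 3 * a + d) a = a * 3 ^ x.length + val3 x := by
    intro x
    induction x with
    | nil => simp [val3]
    | cons b x ih =>
      intro a
      rw [val3, List.foldl_cons, List.foldl_cons, ih, ih, List.length_cons, pow_succ]
      ring
  rw [val3, List.foldl_cons, key]
  simp

theorem val3_lt (x : List ℕ) (hx : ∀ d ∈ x, d < 3) : val3 x < 3 ^ x.length := by
  induction x with
  | nil => simp [val3]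
  | cons d x ih =>
    have h1 := ih fun e he => hx e (List.mem_cons_of_mem _ he)
    have h2 := hx d List.mem_cons_self
    rw [val3_cons, List.length_cons, pow_succ]
    interval_cases d <;> omega

theorem aut_holds (x : List ℕ) (hx : ∀ d ∈ x, d < 3) :
    (aut x).Holds (val3 x) (3 ^ x.length - val3 x) := by
  induction x with
  | nil =>
    have := PQ_pow 0
    rw [pow_zero] at this
    simp [aut, AutState.Holds, val3, PQ_zero, this]
  | cons d x ih =>
    have hx' : ∀ e ∈ x, e < 3 := fun e he => hx e (List.mem_cons_of_mem _ he)
    rw [val3_cons, List.length_cons]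
    exact (ih hx').step (val3_lt x hx') (hx d List.mem_cons_self)

theorem val3_exp3 (n : ℕ) : val3 (exp3 n) = n := by
  rw [val3, exp3, List.foldl_reverse]
  conv_rhs => rw [← Nat.ofDigits_digits 3 n, Nat.ofDigits_eq_foldr]
  congr 1
  funext a b
  simp [add_comm]

theorem pS_eq_qS_iff_aut (n : ℕ) : pS n = qS n ↔ aut (exp3 n) ≠ .two ∧ aut (exp3 n) ≠ .trap := by
  have h := aut_holds (exp3 n) fun d hd =>
    Nat.digits_lt_base (by norm_num) (List.mem_reverse.1 hd)
  rw [val3_exp3] at h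
  rw [pS_eq, qS_eq]
  cases hs : aut (exp3 n) <;> simp only [hs, AutState.Holds, Prod.ext_iff] at h <;> simp <;> omega

theorem aut_append (x y : List ℕ) : aut (x ++ y) = x.foldr autStep (aut y) := by
  simp [aut]

theorem foldr_autStep_replicate {d : ℕ} {s : AutState} (h : autStep d s = s) (l : ℕ) :
    (List.replicate l d).foldr autStep s = s := by
  induction l with
  | zero => rfl
  | succ l ih => rw [List.replicate_succ, List.foldr_cons, ih, h]

theorem aut_replicate_zero (l : ℕ) : aut (List.replicate l 0) = .zero :=
  foldr_autStep_replicate rfl l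

theorem aut_one_zeros (l : ℕ) : aut (1 :: List.replicate l 0) = .one := by
  change autStep 1 (aut (List.replicate l 0)) = .one
  rw [aut_replicate_zero]
  rfl

theorem foldr_autStep_replicate_two {s : AutState} (h : autStep 2 s = .two) (a : ℕ) :
    (List.replicate (a + 2) 2).foldr autStep s = .twos := by
  rw [List.replicate_add, List.foldr_append]
  simp only [List.replicate_succ, List.replicate_zero, List.foldr_cons, List.foldr_nil, h]
  exact foldr_autStep_replicate rfl a

theorem aut_of_inS {x : List ℕ} (h : InS x) : aut x = .twos := by
  induction h with
  | base a t ht =>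
    rw [aut_append]
    refine foldr_autStep_replicate_two ?_ a
    cases ht with
    | zeros l => rw [aut_replicate_zero]; rfl
    | one l m =>
      rw [aut_append, aut_one_zeros, List.replicate_succ', List.foldr_append]
      change autStep 2 ((List.replicate l 0).foldr autStep .zeroOne) = _
      rw [foldr_autStep_replicate rfl]
      rfl
  | step a z x hx ih =>
    rw [List.append_assoc, aut_append, aut_append, ih]
    refine foldr_autStep_replicate_two ?_ a
    rw [List.replicate_add, List.foldr_append]
    change autStep 2 ((List.replicate z 0).foldr autStep .zeroOne) = _
    rw [foldr_autStep_replicate rfl]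
    rfl

theorem InS.cons_two {x : List ℕ} (h : InS x) : InS (2 :: x) := by
  cases h with
  | base a t ht => exact InS.base (a + 1) t ht
  | step a z x hx => exact InS.step (a + 1) z x hx

/-- The digit strings leading to a given state. -/
def AutState.Lang : AutState → List ℕ → Prop
  | .zero, x => ∃ l, x = List.replicate l 0
  | .one, x => (∃ l, x = 1 :: List.replicate l 0) ∨ ∃ y, x = 0 :: y ∧ InS y
  | .zeroOne, x => (∃ l m, x = List.replicate (l + 1) 0 ++ 1 :: List.replicate m 0) ∨
      ∃ z y, x = List.replicate (z + 2) 0 ++ y ∧ InS y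
  | .two, x => (∃ t, STail t ∧ x = 2 :: t) ∨
      ∃ z y, x = 2 :: (List.replicate (z + 2) 0 ++ y) ∧ InS y
  | .twos, x => InS x
  | .trap, _ => True

theorem AutState.Lang.step {s : AutState} {x : List ℕ} {d : ℕ} (hd : d < 3) (h : s.Lang x) :
    (autStep d s).Lang (d :: x) := by
  cases s with
  | zero =>
    obtain ⟨l, rfl⟩ := h
    interval_cases d
    · exact ⟨l + 1, rfl⟩
    · exact Or.inl ⟨l, rfl⟩
    · exact Or.inl ⟨_, STail.zeros l, rfl⟩
  | one =>
    interval_cases d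
    · rcases h with ⟨l, rfl⟩ | ⟨y, rfl, hy⟩
      · exact Or.inl ⟨0, l, rfl⟩
      · exact Or.inr ⟨0, y, rfl, hy⟩
    · trivial
    · trivial
  | zeroOne =>
    interval_cases d
    · rcases h with ⟨l, m, rfl⟩ | ⟨z, y, rfl, hy⟩
      · exact Or.inl ⟨l + 1, m, rfl⟩
      · exact Or.inr ⟨z + 1, y, rfl, hy⟩
    · trivial
    · rcases h with ⟨l, m, rfl⟩ | ⟨z, y, rfl, hy⟩
      · exact Or.inl ⟨_, STail.one l m, rfl⟩
      · exact Or.inr ⟨z, y, rfl, hy⟩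
  | two =>
    interval_cases d
    · trivial
    · trivial
    · rcases h with ⟨t, ht, rfl⟩ | ⟨z, y, rfl, hy⟩
      · exact InS.base 0 t ht
      · exact InS.step 0 z y hy
  | twos =>
    interval_cases d
    · exact Or.inr ⟨x, rfl, h⟩
    · trivial
    · exact h.cons_two
  | trap => interval_cases d <;> trivial

theorem lang_aut (x : List ℕ) (hx : ∀ d ∈ x, d < 3) : (aut x).Lang x := by
  induction x with
  | nil => exact ⟨0, rfl⟩
  | cons d x ih =>
    exact (ih fun e he => hx e (List.mem_cons_of_mem _ he)).step (hx d List.mem_cons_self)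

theorem exp3_ne_zero_cons (n : ℕ) (x : List ℕ) : exp3 n ≠ 0 :: x := by
  intro h
  have h1 : Nat.digits 3 n = x.reverse ++ [0] := by
    rw [← List.reverse_reverse (Nat.digits 3 n)]
    change (exp3 n).reverse = _
    rw [h, List.reverse_cons]
  have hn : n ≠ 0 := by
    rintro rfl
    simp at h1
  have := Nat.getLast_digit_ne_zero 3 hn
  simp [h1] at this

/-- Characterization of the set S of n with p(n) = q(n): p(n) = q(n) iff n = 0
(empty expansion), n = 3ᵏ (expansion 1 0^k), or the ternary expansion of n lies
in (2 2^+ 0 0^+)^* · 2 2^+ · (0^* ∪ 0^+ 1 0^*). -/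
theorem p_eq_q_characterization (n : ℕ) :
    pS n = qS n ↔
      (exp3 n = [] ∨ (∃ k : ℕ, exp3 n = 1 :: List.replicate k 0) ∨ InS (exp3 n)) := by
  rw [pS_eq_qS_iff_aut]
  constructor
  · intro h
    have hl := lang_aut (exp3 n) fun d hd =>
      Nat.digits_lt_base (by norm_num) (List.mem_reverse.1 hd)
    cases hs : aut (exp3 n) <;> rw [hs] at h hl
    case zero =>
      obtain ⟨_ | l, hl⟩ := hl
      · exact Or.inl hl
      · exact (exp3_ne_zero_cons n _ hl).elim
    case one =>
      rcases hl with hl | ⟨y, hl, -⟩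
      · exact Or.inr (Or.inl hl)
      · exact (exp3_ne_zero_cons n _ hl).elim
    case zeroOne =>
      rcases hl with ⟨l, m, hl⟩ | ⟨z, y, hl, -⟩
      · exact (exp3_ne_zero_cons n _ hl).elim
      · exact (exp3_ne_zero_cons n _ hl).elim
    case twos => exact Or.inr (Or.inr hl)
    case two => exact (h.1 rfl).elim
    case trap => exact (h.2 rfl).elim
  · rintro (h | ⟨k, h⟩ | h)
    · rw [h]
      exact ⟨nofun, nofun⟩
    · rw [h, aut_one_zeros]
      exact ⟨nofun, nofun⟩
    · rw [aut_of_inS h]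
      exact ⟨nofun, nofun⟩
end
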